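/- Let B be a d×d real matrix with det B = 1 such that for every nonzero x ∈ ℤ^d some coordinate of the vector Bx is a nonzero integer. Then some row of B is an integer vector. -/

import Mathlib

open scoped ArithmeticFunction.Omega

section AddSubgroup

variable {V : Type*} [AddCommGroup V]

/-- A proper subgroup of finite index is contained in a subgroup of prime index. -/
theorem AddSubgroup.exists_le_prime_index (P : AddSubgroup V) [P.FiniteIndex] (hP : P ≠ ⊤) :
    ∃ W : AddSubgroup V, P ≤ W ∧ W.index.Prime := by
  have : Finite (V ⧸ P) := P.finite_quotient_of_finiteIndex
  have : Nontrivial (V ⧸ P) := by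
    rwa [QuotientAddGroup.nontrivial_iff]
  obtain ⟨A, hA⟩ := IsCoatomic.exists_coatom (AddSubgroup (V ⧸ P))
  have : IsSimpleAddGroup ((V ⧸ P) ⧸ A) :=
    { exists_pair_ne := by
        have : Nontrivial ((V ⧸ P) ⧸ A) := QuotientAddGroup.nontrivial_iff.2 hA.1
        exact this.exists_pair_ne
      eq_bot_or_eq_top_of_normal := fun H _ => by
        have hle : A ≤ H.comap (QuotientAddGroup.mk' A) :=
          (QuotientAddGroup.ker_mk' A).symm.trans_le (AddMonoidHom.ker_le_comap _ _)
        have hmap := AddSubgroup.map_comap_eq_self_of_surjective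
          (QuotientAddGroup.mk'_surjective A) H
        rcases hA.le_iff.1 hle with h | h
        · rw [h, AddSubgroup.map_top_of_surjective _ (QuotientAddGroup.mk'_surjective A)] at hmap
          exact Or.inr hmap.symm
        · rw [h, QuotientAddGroup.map_mk'_self] at hmap
          exact Or.inl hmap.symm }
  refine ⟨A.comap (QuotientAddGroup.mk' P), ?_, ?_⟩
  · intro x hx
    have : (QuotientAddGroup.mk' P) x = 0 := (QuotientAddGroup.eq_zero_iff x).2 hx
    rw [AddSubgroup.mem_comap, this]
    exact A.zero_mem
  · rw [AddSubgroup.index_comap_of_surjective _ (QuotientAddGroup.mk'_surjective P)]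
    exact IsSimpleAddGroup.prime_card

/-- Relative version of `AddSubgroup.exists_le_prime_index`. -/
theorem AddSubgroup.exists_prime_relIndex (M P : AddSubgroup V) [P.FiniteIndex] (hP : ¬ M ≤ P) :
    ∃ W : AddSubgroup V, M ⊓ P ≤ W ∧ W ≤ M ∧ (W.relIndex M).Prime := by
  obtain ⟨W, hW, hprime⟩ := (P.addSubgroupOf M).exists_le_prime_index
    (by rwa [Ne, AddSubgroup.addSubgroupOf_eq_top])
  refine ⟨W.map M.subtype, ?_, AddSubgroup.map_subtype_le W, ?_⟩
  · rintro x ⟨hxM, hxP⟩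
    exact ⟨⟨x, hxM⟩, hW hxP, rfl⟩
  · rw [AddSubgroup.relIndex, AddSubgroup.addSubgroupOf,
      AddSubgroup.comap_map_eq_self_of_injective (AddSubgroup.subtype_injective M)]
    exact hprime

theorem AddSubgroup.relIndex_mul_relIndex_sup {H K M : AddSubgroup V} (hHK : H ≤ K)
    (hMK : M ≤ K) : H.relIndex M * (H ⊔ M).relIndex K = H.relIndex K := by
  rw [← AddSubgroup.relIndex_mul_relIndex H (H ⊔ M) K le_sup_left (sup_le hHK hMK), sup_comm,
    AddSubgroup.relIndex_sup_right]

theorem AddSubgroup.relIndex_ne_zero_of_finiteIndex (A B : AddSubgroup V) [A.FiniteIndex] :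
    A.relIndex B ≠ 0 :=
  fun h => AddSubgroup.FiniteIndex.index_ne_zero (AddSubgroup.index_eq_zero_of_relIndex_eq_zero h)

theorem AddSubgroup.cardFactors_relIndex_le_of_le_left {A B : AddSubgroup V} (C : AddSubgroup V)
    [A.FiniteIndex] (h : A ≤ B) : Ω (B.relIndex C) ≤ Ω (A.relIndex C) := by
  obtain ⟨k, hk⟩ := AddSubgroup.relIndex_dvd_of_le_left C h
  have h0 : A.relIndex C ≠ 0 := AddSubgroup.relIndex_ne_zero_of_finiteIndex _ _
  rw [hk] at h0 ⊢
  rw [ArithmeticFunction.cardFactors_mul (left_ne_zero_of_mul h0) (right_ne_zero_of_mul h0)]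
  omega

theorem AddSubgroup.cardFactors_relIndex_inf (A B C : AddSubgroup V)
    [A.FiniteIndex] [B.FiniteIndex] :
    Ω ((A ⊓ B).relIndex C) = Ω (A.relIndex (B ⊓ C)) + Ω (B.relIndex C) := by
  rw [← AddSubgroup.relIndex_inf_mul_relIndex, ArithmeticFunction.cardFactors_mul
    (AddSubgroup.relIndex_ne_zero_of_finiteIndex _ _)
    (AddSubgroup.relIndex_ne_zero_of_finiteIndex _ _)]

theorem AddSubgroup.cardFactors_relIndex_trans (A : AddSubgroup V) {B C : AddSubgroup V}
    [A.FiniteIndex] (h : B ≤ C) (hBC : B.relIndex C ≠ 0) :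
    Ω (A.relIndex C) ≤ Ω (A.relIndex B) + Ω (B.relIndex C) := by
  have h1 : A.relIndex B * B.relIndex C = (A ⊓ B).relIndex C := by
    rw [← AddSubgroup.relIndex_inf_mul_relIndex, inf_eq_left.2 h]
  obtain ⟨k, hk⟩ := AddSubgroup.relIndex_dvd_of_le_left C (inf_le_left : A ⊓ B ≤ A)
  have h0 : A.relIndex B * B.relIndex C ≠ 0 :=
    mul_ne_zero (AddSubgroup.relIndex_ne_zero_of_finiteIndex _ _) hBC
  rw [← ArithmeticFunction.cardFactors_mul (AddSubgroup.relIndex_ne_zero_of_finiteIndex _ _) hBC,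
    h1, hk]
  rw [h1, hk] at h0
  rw [ArithmeticFunction.cardFactors_mul (left_ne_zero_of_mul h0) (right_ne_zero_of_mul h0)]
  omega

theorem AddSubgroup.finiteIndex_finset_inf {ι : Type*} (F : Finset ι) (H : ι → AddSubgroup V)
    (hH : ∀ i, (H i).FiniteIndex) : (F.inf H).FiniteIndex := by
  induction F using Finset.cons_induction with
  | empty => rw [Finset.inf_empty]; infer_instance
  | cons a s ha ih => rw [Finset.inf_cons]; have := hH a; infer_instance

end AddSubgroup

section Covering

variable {V : Type*} [AddCommGroup V]

/-- `D` is either the subgroup `K = H`, or the complement in the subgroup `K` of a subgroup `H`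
whose index in `K` divides a prime. -/
def IsSlab (D : Set V) (K H : AddSubgroup V) : Prop :=
  (D = K ∧ H = K) ∨ (D = (K : Set V) \ H ∧ H ≤ K ∧ ∃ p : ℕ, p.Prime ∧ H.relIndex K ∣ p)

namespace IsSlab

variable {D : Set V} {K H : AddSubgroup V}

theorem le (h : IsSlab D K H) : H ≤ K := by
  rcases h with ⟨-, rfl⟩ | ⟨-, h, -⟩
  · exact le_rfl
  · exact h

theorem subset (h : IsSlab D K H) : D ⊆ K := by
  rcases h with ⟨rfl, -⟩ | ⟨rfl, -, -⟩
  · exact subset_rfl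
  · exact Set.sdiff_subset

theorem add_mem_iff (h : IsSlab D K H) {x y : V} (hy : y ∈ H) : x + y ∈ D ↔ x ∈ D := by
  have hyK := h.le hy
  rcases h with ⟨rfl, -⟩ | ⟨rfl, -, -⟩
  · exact K.add_mem_cancel_right hyK
  · simp only [Set.mem_sdiff, SetLike.mem_coe, K.add_mem_cancel_right hyK,
      H.add_mem_cancel_right hy]

/-- A nonempty `M`-invariant set contains a coset of a prime-index subgroup of `M` that avoids
a given slab, unless `M` leaves the slab invariant. -/
theorem exists_coset_disjoint (h : IsSlab D K H) [H.FiniteIndex] {M : AddSubgroup V}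
    (hM : ¬ M ≤ H) {X : Set V} (hne : X.Nonempty) (hX : ∀ x ∈ X, ∀ m ∈ M, x + m ∈ X) :
    ∃ W ≤ M, (W.relIndex M).Prime ∧ ∃ x, ∀ w ∈ W, x + w ∈ X ∧ x + w ∉ D := by
  by_cases hMK : M ≤ K
  · rcases h with ⟨-, rfl⟩ | ⟨rfl, hHK, p, hp, hdvd⟩
    · exact absurd hMK hM
    have hmul := AddSubgroup.relIndex_mul_relIndex_sup hHK hMK
    have hMH : H.relIndex M = p :=
      ((Nat.dvd_prime hp).1 ((Dvd.intro _ hmul).trans hdvd)).resolve_left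
        (by rwa [AddSubgroup.relIndex_eq_one])
    have hKsup : K ≤ H ⊔ M := by
      rw [← AddSubgroup.relIndex_eq_one]
      rw [← hmul, hMH] at hdvd
      exact Nat.dvd_one.1 ((Nat.mul_dvd_mul_iff_left hp.pos).1 (by simpa using hdvd))
    refine ⟨H ⊓ M, inf_le_right, by rwa [AddSubgroup.inf_relIndex_right, hMH], ?_⟩
    obtain ⟨x, hx⟩ := hne
    by_cases hxK : x ∈ K
    · obtain ⟨a, ha, m, hm, rfl⟩ := AddSubgroup.mem_sup.1 (hKsup hxK)
      refine ⟨a, fun w hw => ⟨?_, fun hD => hD.2 (H.add_mem ha hw.1)⟩⟩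
      have := hX _ hx (-m + w) (M.add_mem (M.neg_mem hm) hw.2)
      rwa [add_assoc, add_neg_cancel_left] at this
    · exact ⟨x, fun w hw => ⟨hX x hx w hw.2,
        fun hD => hxK ((K.add_mem_cancel_right (hMK hw.2)).1 hD.1)⟩⟩
  · have : K.FiniteIndex := AddSubgroup.finiteIndex_of_le h.le
    obtain ⟨W, hW, hWM, hprime⟩ := M.exists_prime_relIndex K hMK
    refine ⟨W, hWM, hprime, ?_⟩
    obtain ⟨x, hx⟩ := hne
    by_cases hxW : ∃ w ∈ W, x + w ∈ D
    · obtain ⟨w, hw, hxw⟩ := hxW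
      have : ¬ M ≤ W := fun hle => hprime.ne_one (AddSubgroup.relIndex_eq_one.2 hle)
      obtain ⟨m, hm, hmW⟩ := SetLike.not_le_iff_exists.1 this
      refine ⟨x + w + m, fun w' hw' => ⟨?_, fun hD => hmW ?_⟩⟩
      · exact hX _ (hX _ (hX _ hx _ (hWM hw)) _ hm) _ (hWM hw')
      · have h1 : m + w' ∈ K := by
          have := h.subset hD
          rw [add_assoc] at this
          exact (K.add_mem_cancel_left (h.subset hxw)).1 this
        exact (W.add_mem_cancel_right hw').1 (hW ⟨M.add_mem hm (hWM hw'), h1⟩)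
    · push Not at hxW
      exact ⟨x, fun w hw => ⟨hX x hx w (hWM hw), hxW w hw⟩⟩

end IsSlab

/-- A covering by slabs of a nonempty set invariant under `M` has a subcovering by `n` slabs whose
common stabilizer has index in `M` with fewer than `n` prime factors. -/
theorem exists_subcover {ι : Type*} {D : ι → Set V} {K H : ι → AddSubgroup V}
    (hD : ∀ i, IsSlab (D i) (K i) (H i)) (hH : ∀ i, (H i).FiniteIndex) (F : Finset ι)
    (M : AddSubgroup V) (X : Set V) (hne : X.Nonempty) (hX : ∀ x ∈ X, ∀ m ∈ M, x + m ∈ X)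
    (hcov : ∀ x ∈ X, ∃ i ∈ F, x ∈ D i) :
    ∃ T ⊆ F, (∀ x ∈ X, ∃ i ∈ T, x ∈ D i) ∧ Ω ((T.inf H).relIndex M) < T.card := by
  classical
  induction F using Finset.strongInduction generalizing M X with
  | H F ih =>
  have hfin := fun F : Finset ι => AddSubgroup.finiteIndex_finset_inf F H hH
  by_cases hproper : ∃ F' ⊂ F, ∀ x ∈ X, ∃ i ∈ F', x ∈ D i
  · obtain ⟨F', hF', hcov'⟩ := hproper
    obtain ⟨T, hT, h⟩ := ih F' hF' M X hne hX hcov'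
    exact ⟨T, hT.trans hF'.subset, h⟩
  push Not at hproper
  refine ⟨F, subset_rfl, hcov, ?_⟩
  by_cases hall : ∀ i ∈ F, M ≤ H i
  · rw [AddSubgroup.relIndex_eq_one.2 (Finset.le_inf hall), ArithmeticFunction.cardFactors_one,
      Finset.card_pos]
    obtain ⟨x, hx⟩ := hne
    obtain ⟨i, hi, -⟩ := hcov x hx
    exact ⟨i, hi⟩
  push Not at hall
  obtain ⟨i, hi, hMi⟩ := hall
  have := hH i
  obtain ⟨W, hWM, hprime, x, hx⟩ := (hD i).exists_coset_disjoint hMi hne hX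
  obtain ⟨F₁, hF₁, hcov₁, hΩ₁⟩ := ih (F.erase i) (Finset.erase_ssubset hi) W
    {y | y - x ∈ W} ⟨x, by simp⟩
    (fun y hy w hw => by
      rw [Set.mem_ofPred_eq, add_sub_right_comm]
      exact W.add_mem hy hw)
    (fun y hy => by
      obtain ⟨h1, h2⟩ := hx _ hy
      rw [add_sub_cancel] at h1 h2
      obtain ⟨j, hj, hyj⟩ := hcov y h1
      exact ⟨j, Finset.mem_erase.2 ⟨fun h => h2 (h ▸ hyj), hj⟩, hyj⟩)
  have hF₁ss : F₁ ⊂ F := hF₁.trans_ssubset (Finset.erase_ssubset hi)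
  have hF₁ne : F₁.Nonempty := Finset.card_pos.1 (by omega)
  obtain ⟨F₂, hF₂, hcov₂, hΩ₂⟩ := ih (F \ F₁) (Finset.sdiff_ssubset hF₁ss.subset hF₁ne)
    (F₁.inf H ⊓ M) {y | y ∈ X ∧ ∀ j ∈ F₁, y ∉ D j} (hproper F₁ hF₁ss)
    (fun y hy m hm => ⟨hX y hy.1 m hm.2, fun j hj hyj =>
      hy.2 j hj (((hD j).add_mem_iff ((Finset.inf_le hj : F₁.inf H ≤ H j) hm.1)).1 hyj)⟩)
    (fun y hy => by
      obtain ⟨j, hj, hyj⟩ := hcov y hy.1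
      exact ⟨j, Finset.mem_sdiff.2 ⟨hj, fun h => hy.2 j h hyj⟩, hyj⟩)
  have hunion : F₂ ∪ F₁ = F := by
    by_contra hne
    have hss : F₂ ∪ F₁ ⊂ F := Finset.ssubset_iff_subset_ne.2
      ⟨Finset.union_subset (hF₂.trans Finset.sdiff_subset) hF₁ss.subset, hne⟩
    obtain ⟨y, hy, hyc⟩ := hproper _ hss
    obtain ⟨j, hj, hyj⟩ := hcov₂ y
      ⟨hy, fun j hj => hyc j (Finset.mem_union_right _ hj)⟩
    exact hyc j (Finset.mem_union_left _ hj) hyj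
  have hcard : F.card = F₂.card + F₁.card := by
    rw [← hunion, Finset.card_union_of_disjoint]
    exact Finset.disjoint_of_subset_left hF₂ Finset.sdiff_disjoint
  have h1 := hfin F₁
  have h2 := hfin F₂
  have h3 := AddSubgroup.cardFactors_relIndex_inf (F₂.inf H) (F₁.inf H) M
  have h4 := (F₁.inf H).cardFactors_relIndex_trans hWM hprime.ne_zero
  rw [ArithmeticFunction.cardFactors_apply_prime hprime] at h4
  rw [← hunion, Finset.inf_union, hunion, h3, hcard]
  omega

section Factorization

variable {ι : Type*} {K H : ι → AddSubgroup V}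

/-- A version of `exists_subcover` where one of the covering sets is a subgroup `S`. -/
theorem exists_subcover_of_subgroup (hHK : ∀ i, H i ≤ K i) (hH : ∀ i, (H i).FiniteIndex)
    (hp : ∀ i, ∃ p : ℕ, p.Prime ∧ (H i).relIndex (K i) ∣ p) (S M : AddSubgroup V)
    [hS : S.FiniteIndex] (A : Finset ι) (hcov : ∀ x ∈ M, x ∈ S ∨ ∃ i ∈ A, x ∈ K i ∧ x ∉ H i) :
    ∃ T ⊆ A, (∀ x ∈ M, x ∈ S ∨ ∃ i ∈ T, x ∈ K i ∧ x ∉ H i) ∧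
      Ω ((S ⊓ T.inf H).relIndex M) ≤ T.card := by
  classical
  let D' : Option ι → Set V := fun o => o.elim S fun i => (K i : Set V) \ H i
  let K' : Option ι → AddSubgroup V := fun o => o.elim S K
  let H' : Option ι → AddSubgroup V := fun o => o.elim S H
  obtain ⟨T, hT, hcovT, hΩ⟩ := exists_subcover (D := D') (K := K') (H := H')
    (by
      rintro (_ | i)
      · exact Or.inl ⟨rfl, rfl⟩
      · exact Or.inr ⟨rfl, hHK i, hp i⟩)
    (by
      rintro (_ | i)
      · exact hS
      · exact hH i)
    A.insertNone M M ⟨0, M.zero_mem⟩ (fun x hx m hm => M.add_mem hx hm)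
    (fun x hx => by
      rcases hcov x hx with h | ⟨i, hi, h⟩
      · exact ⟨none, Finset.none_mem_insertNone, h⟩
      · exact ⟨some i, Finset.some_mem_insertNone.2 hi, h⟩)
  have hnone : none ∈ T := by
    obtain ⟨_ | i, hi, h⟩ := hcovT 0 M.zero_mem
    · exact hi
    · exact absurd (H i).zero_mem h.2
  have hTeq : T = T.eraseNone.insertNone := by
    rw [Finset.insertNone_eraseNone, Finset.insert_eq_of_mem hnone]
  rw [hTeq] at hΩ
  refine ⟨T.eraseNone, ?_, ?_, ?_⟩
  · intro i hi
    exact Finset.some_mem_insertNone.1 (hT (Finset.mem_eraseNone.1 hi))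
  · intro x hx
    obtain ⟨_ | i, hi, h⟩ := hcovT x hx
    · exact Or.inl h
    · exact Or.inr ⟨i, Finset.mem_eraseNone.2 hi, h⟩
  · rw [Finset.card_insertNone, Nat.lt_succ_iff] at hΩ
    have hinf : T.eraseNone.insertNone.inf H' = S ⊓ T.eraseNone.inf H := by
      simp only [Finset.insertNone, OrderEmbedding.coe_ofMapLEIff, Finset.inf_cons,
        Finset.inf_map]
      rfl
    rwa [hinf] at hΩ

/-- If the complement of `⨅ i ∈ J, H i` is covered by the sets `K i \ H i`, then `J \ A` bounds the
number of prime factors of the index of this subgroup in `⨅ i ∈ A, H i`. -/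
theorem cardFactors_relIndex_inf_le [DecidableEq ι] (hHK : ∀ i, H i ≤ K i)
    (hH : ∀ i, (H i).FiniteIndex)
    (hp : ∀ i, ∃ p : ℕ, p.Prime ∧ (H i).relIndex (K i) ∣ p) (J : Finset ι)
    (hcov : ∀ x ∉ J.inf H, ∃ i ∈ J, x ∈ K i ∧ x ∉ H i) (A : Finset ι) :
    Ω ((J.inf H).relIndex (A.inf H)) ≤ (J \ A).card := by
  have hfin := fun F : Finset ι => AddSubgroup.finiteIndex_finset_inf F H hH
  have := hfin J
  obtain ⟨T, hT, -, hΩ⟩ := exists_subcover_of_subgroup hHK hH hp (J.inf H) (A.inf H) (J \ A)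
    (fun x hx => by
      by_cases hxJ : x ∈ J.inf H
      · exact Or.inl hxJ
      · obtain ⟨i, hi, h⟩ := hcov x hxJ
        exact Or.inr ⟨i, Finset.mem_sdiff.2
          ⟨hi, fun hA => h.2 ((Finset.inf_le hA : A.inf H ≤ H i) hx)⟩, h⟩)
  have := hfin T
  exact (AddSubgroup.cardFactors_relIndex_le_of_le_left _ inf_le_left).trans
    (hΩ.trans (Finset.card_le_card hT))

/-- Hajós' theorem for slabs: if the complement of `⨅ i ∈ J, H i` is covered by the sets
`K i \ H i` and the index of this subgroup has at least as many prime factors as there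
are slabs, then one of the `K i` is the whole group. -/
theorem exists_eq_top_of_cover (hHK : ∀ i, H i ≤ K i) (hH : ∀ i, (H i).FiniteIndex)
    (hp : ∀ i, ∃ p : ℕ, p.Prime ∧ (H i).relIndex (K i) ∣ p) (J : Finset ι) (hJ : J.Nonempty)
    (hcov : ∀ x ∉ J.inf H, ∃ i ∈ J, x ∈ K i ∧ x ∉ H i)
    (hcard : J.card ≤ Ω (J.inf H).index) : ∃ i ∈ J, K i = ⊤ := by
  classical
  induction J using Finset.strongInduction with
  | H J ih =>
  have hfin := fun F : Finset ι => AddSubgroup.finiteIndex_finset_inf F H hH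
  obtain ⟨j, hj⟩ := hJ
  have hKj : (K j).FiniteIndex := have := hH j; AddSubgroup.finiteIndex_of_le (hHK j)
  obtain ⟨T, hTj, hcovT, hΩT⟩ := exists_subcover_of_subgroup hHK hH hp (K j) ⊤ (J.erase j)
    (fun x _ => by
      by_cases hx : x ∈ J.inf H
      · exact Or.inl (hHK j ((Finset.inf_le hj : J.inf H ≤ H j) hx))
      · obtain ⟨i, hi, h⟩ := hcov x hx
        by_cases hij : i = j
        · exact Or.inl (hij ▸ h.1)
        · exact Or.inr ⟨i, Finset.mem_erase.2 ⟨hij, hi⟩, h⟩)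
  rcases T.eq_empty_or_nonempty with rfl | hTne
  · refine ⟨j, hj, eq_top_iff.2 fun x hx => ?_⟩
    simpa using hcovT x hx
  have hTss : T ⊂ J := hTj.trans_ssubset (Finset.erase_ssubset hj)
  have := hfin T
  have hUT : Ω (T.inf H).index ≤ T.card := by
    rw [← AddSubgroup.relIndex_top_right]
    exact (AddSubgroup.cardFactors_relIndex_le_of_le_left _ inf_le_right).trans hΩT
  have hLU : J.inf H ≤ T.inf H := Finset.inf_mono hTss.subset
  have hmul : Ω (J.inf H).index = Ω ((J.inf H).relIndex (T.inf H)) + Ω (T.inf H).index := by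
    have := hfin J
    rw [← AddSubgroup.relIndex_mul_index hLU, ArithmeticFunction.cardFactors_mul
      (AddSubgroup.relIndex_ne_zero_of_finiteIndex _ _) AddSubgroup.FiniteIndex.index_ne_zero]
  have hsd : (J \ T).card + T.card = J.card := Finset.card_sdiff_add_card_eq_card hTss.subset
  have hle := cardFactors_relIndex_inf_le hHK hH hp J hcov
  obtain ⟨i, hi, h⟩ := ih T hTss hTne
    (fun x hx => by
      by_contra! hcon
      have hdisj : ∀ y, y - x ∈ T.inf H → ∀ i ∈ T, y ∈ K i → y ∈ H i := by
        intro y hy i hi hyK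
        have hyx : y - x ∈ H i := (Finset.inf_le hi : T.inf H ≤ H i) hy
        have hxK : x ∈ K i := by
          have := (K i).sub_mem hyK (hHK i hyx)
          rwa [sub_sub_cancel] at this
        have := (H i).add_mem hyx (hcon i hi hxK)
        rwa [sub_add_cancel] at this
      obtain ⟨F, hF, -, hΩF⟩ := exists_subcover (D := fun i => (K i : Set V) \ H i)
        (fun i => Or.inr ⟨rfl, hHK i, hp i⟩) hH (J \ T) (T.inf H) {y | y - x ∈ T.inf H}
        ⟨x, by simp⟩
        (fun y hy m hm => by
          rw [Set.mem_ofPred_eq, add_sub_right_comm]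
          exact AddSubgroup.add_mem _ hy hm)
        (fun y hy => by
          have hyL : y ∉ J.inf H := fun hyL => hx <| by
            have := AddSubgroup.sub_mem _ (hLU hyL) hy
            rwa [sub_sub_cancel] at this
          obtain ⟨i, hi, h⟩ := hcov y hyL
          exact ⟨i, Finset.mem_sdiff.2 ⟨hi, fun hT => h.2 (hdisj y hy i hT h.1)⟩, h⟩)
      have := hfin F
      have := hfin J
      have h1 := AddSubgroup.cardFactors_relIndex_inf (J.inf H) (F.inf H) (T.inf H)
      rw [inf_eq_left.2 (Finset.inf_mono (hF.trans Finset.sdiff_subset)), ← Finset.inf_union] at h1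
      have h2 := hle (F ∪ T)
      have h3 : (J \ (F ∪ T)).card + F.card = (J \ T).card := by
        rw [Finset.union_comm, ← Finset.card_sdiff_add_card_eq_card hF, sdiff_sdiff_left]
        rfl
      omega)
    (by have := hle T; omega)
  exact ⟨i, hTss.subset hi, h⟩

end Factorization

end Covering

section IntegerMatrix

open Matrix

theorem AddSubgroup.relIndex_comap_zmultiples_dvd {V : Type*} [AddCommGroup V] (f : V →+ ℤ)
    {a : ℤ} (ha : a ≠ 0) (p : ℕ) :
    ((AddSubgroup.zmultiples (a * p)).comap f).relIndex
      ((AddSubgroup.zmultiples a).comap f) ∣ p := by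
  have hle : AddSubgroup.zmultiples (a * p) ≤ AddSubgroup.zmultiples a :=
    fun x hx => Int.mem_zmultiples_iff.2 ((Dvd.intro _ rfl).trans (Int.mem_zmultiples_iff.1 hx))
  have hp : (AddSubgroup.zmultiples (a * p)).relIndex (AddSubgroup.zmultiples a) = p := by
    have := AddSubgroup.relIndex_mul_index hle
    rw [Int.index_zmultiples, Int.index_zmultiples, Int.natAbs_mul, Int.natAbs_natCast,
      mul_comm] at this
    exact Nat.eq_of_mul_eq_mul_left (Int.natAbs_pos.2 ha) this
  rw [AddSubgroup.relIndex_comap]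
  have := AddSubgroup.relIndex_mul_relIndex_sup hle
    (AddSubgroup.map_comap_le f (AddSubgroup.zmultiples a))
  rw [hp] at this
  exact Dvd.intro _ this

theorem Nat.exists_divisor_chain {q : ℕ} (hq : q ≠ 0) :
    ∃ c : ℕ → ℕ, c 0 = 1 ∧ c (Ω q) = q ∧ ∀ k < Ω q, ∃ p : ℕ, p.Prime ∧ c (k + 1) = c k * p := by
  refine ⟨fun k => (q.primeFactorsList.take k).prod, by simp, ?_, fun k hk => ?_⟩
  · simp only [ArithmeticFunction.cardFactors_apply, List.take_length]
    exact Nat.prod_primeFactorsList hq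
  · rw [ArithmeticFunction.cardFactors_apply] at hk
    exact ⟨q.primeFactorsList[k], Nat.prime_of_mem_primeFactorsList (List.getElem_mem hk),
      List.prod_take_succ _ _ hk⟩

theorem Matrix.index_range_mulVec {n : Type*} [Fintype n] [DecidableEq n] (E : Matrix n n ℤ)
    (hE : E.det ≠ 0) : (E.mulVecLin.range.toAddSubgroup).index = E.det.natAbs := by
  have hinj : Function.Injective E.mulVecLin := Matrix.mulVec_injective_of_det_ne_zero hE
  let b : Module.Basis n ℤ E.mulVecLin.range.toAddSubgroup :=
    (Pi.basisFun ℤ n).map (LinearEquiv.ofInjective E.mulVecLin hinj)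
  have hb : (fun i => (b i : n → ℤ)) = fun i j => E j i := by
    ext i j
    have : b i = LinearEquiv.ofInjective E.mulVecLin hinj (Pi.single i 1) := by simp [b]
    rw [this, LinearEquiv.ofInjective_apply, Matrix.mulVecLin_apply, Matrix.mulVec_single_one]
    rfl
  rw [AddSubgroup.index_eq_natAbs_det (Pi.basisFun ℤ n) _ b, hb]
  exact congrArg Int.natAbs ((Pi.basisFun_det_apply _).trans (Matrix.det_transpose E))

/-- The integral case: `C / m` has determinant one. -/
theorem exists_row_dvd {n : Type*} [Fintype n] [DecidableEq n] [Nonempty n] (C : Matrix n n ℤ)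
    {m : ℕ} (hm : 1 < m) (hdet : C.det = (m : ℤ) ^ Fintype.card n)
    (h : ∀ x : n → ℤ, x ≠ 0 → ∃ i, (m : ℤ) ∣ (C *ᵥ x) i ∧ (C *ᵥ x) i ≠ 0) :
    ∃ i, ∀ j, (m : ℤ) ∣ C i j := by
  obtain ⟨q, hq⟩ : ∃ q : ℕ, q = m ^ Fintype.card n := ⟨_, rfl⟩
  have hcard : Fintype.card n ≠ 0 := Fintype.card_ne_zero
  have hq1 : 1 < q := hq ▸ Nat.one_lt_pow hcard hm
  have hm0 : (m : ℤ) ≠ 0 := by omega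
  have hdetq : C.det = q := by rw [hdet, hq]; push_cast; rfl
  have hq0 : (q : ℤ) ≠ 0 := by omega
  obtain ⟨c, hc0, hcq, hc⟩ := Nat.exists_divisor_chain (q := q) (by omega)
  let f : n → (n → ℤ) →+ ℤ := fun i =>
    ((LinearMap.proj i : (n → ℤ) →ₗ[ℤ] ℤ) ∘ₗ C.mulVecLin).toAddMonoidHom
  have hf : ∀ i x, f i x = (C *ᵥ x) i := fun i x => rfl
  let G : n → ℕ → AddSubgroup (n → ℤ) := fun i k =>
    (AddSubgroup.zmultiples ((m : ℤ) * c k)).comap (f i)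
  have hG : ∀ i k x, x ∈ G i k ↔ (m : ℤ) * c k ∣ (C *ᵥ x) i := fun i k x => by
    rw [AddSubgroup.mem_comap, Int.mem_zmultiples_iff, hf]
  have hcpos : ∀ k ≤ Ω q, c k ≠ 0 := by
    intro k hk
    induction k with
    | zero => simp [hc0]
    | succ k ih =>
      obtain ⟨p, hp, hcp⟩ := hc k hk
      rw [hcp]
      exact mul_ne_zero (ih (by omega)) hp.ne_zero
  let K : n × Fin (Ω q) → AddSubgroup (n → ℤ) := fun a => G a.1 a.2
  let H : n × Fin (Ω q) → AddSubgroup (n → ℤ) := fun a => G a.1 (a.2 + 1)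
  have hHK : ∀ a, H a ≤ K a := by
    rintro ⟨i, k⟩ x hx
    obtain ⟨p, -, hcp⟩ := hc k k.2
    rw [hG] at hx ⊢
    refine Dvd.dvd.trans ?_ hx
    rw [hcp, Nat.cast_mul, ← mul_assoc]
    exact Dvd.intro _ rfl
  have hH : ∀ a, (H a).FiniteIndex := by
    rintro ⟨i, k⟩
    have : (AddSubgroup.zmultiples ((m : ℤ) * c (k + 1))).FiniteIndex := by
      refine ⟨?_⟩
      rw [Int.index_zmultiples]
      exact Int.natAbs_ne_zero.2 (mul_ne_zero hm0 (Nat.cast_ne_zero.2 (hcpos _ k.2)))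
    exact ⟨(AddSubgroup.index_comap (AddSubgroup.zmultiples ((m : ℤ) * c (k + 1))) (f i)).trans_ne
      (AddSubgroup.relIndex_ne_zero_of_finiteIndex _ _)⟩
  have hp : ∀ a, ∃ p : ℕ, p.Prime ∧ (H a).relIndex (K a) ∣ p := by
    rintro ⟨i, k⟩
    obtain ⟨p, hp, hcp⟩ := hc k k.2
    refine ⟨p, hp, ?_⟩
    have := AddSubgroup.relIndex_comap_zmultiples_dvd (f i)
      (mul_ne_zero hm0 (Nat.cast_ne_zero.2 (hcpos k k.2.le))) p
    simpa only [H, K, G, hcp, Nat.cast_mul, mul_assoc] using this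
  have hL : ∀ x, x ∈ Finset.univ.inf H ↔ ∀ i, (m : ℤ) * q ∣ (C *ᵥ x) i := by
    intro x
    rw [Finset.inf_eq_iInf]
    simp only [Finset.mem_univ, iInf_pos, AddSubgroup.mem_iInf]
    constructor
    · intro hx i
      have hpos : 0 < Ω q := ArithmeticFunction.cardFactors_pos_iff_one_lt.2 hq1
      have := (hG _ _ _).1 (hx (i, ⟨Ω q - 1, by omega⟩))
      simpa [Nat.sub_add_cancel hpos, hcq] using this
    · rintro hx ⟨i, k⟩
      refine (hG _ _ _).2 (Dvd.dvd.trans (mul_dvd_mul_left _ ?_) (hx i))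
      have hdvd : ∀ l ≤ Ω q, c l ∣ q := by
        intro l hl
        induction hl using Nat.decreasingInduction with
        | self => rw [hcq]
        | of_succ l hl ih =>
          obtain ⟨p, -, hcp⟩ := hc l hl
          exact (Dvd.intro _ hcp.symm).trans ih
      exact Int.natCast_dvd_natCast.2 (hdvd _ k.2)
  set E : Matrix n n ℤ := (m : ℤ) • C.adjugate with hE
  have hCE : ∀ y : n → ℤ, C *ᵥ (E *ᵥ y) = ((m : ℤ) * q) • y := by
    intro y
    rw [Matrix.mulVec_mulVec, hE, Matrix.mul_smul, Matrix.mul_adjugate, hdetq, smul_smul,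
      Matrix.smul_mulVec, Matrix.one_mulVec]
  have hCinj : Function.Injective C.mulVec :=
    Matrix.mulVec_injective_of_det_ne_zero (hdetq ▸ hq0)
  have hLE : Finset.univ.inf H = E.mulVecLin.range.toAddSubgroup := by
    ext x
    rw [hL]
    constructor
    · intro hx
      choose y hy using hx
      refine ⟨y, hCinj ?_⟩
      rw [Matrix.mulVecLin_apply, hCE]
      ext i
      rw [Pi.smul_apply, smul_eq_mul, hy]
    · rintro ⟨y, rfl⟩ i
      rw [Matrix.mulVecLin_apply, hCE]
      exact Dvd.intro _ rfl
  have hEdet : E.det = (q : ℤ) ^ Fintype.card n := by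
    rw [hE, Matrix.det_smul, Matrix.det_adjugate, hdetq, hq, ← Nat.cast_pow, ← Nat.cast_pow,
      ← Nat.cast_mul, ← pow_succ', Nat.sub_add_cancel (Nat.pos_of_ne_zero hcard), Nat.cast_pow]
  have hindex : (Finset.univ.inf H).index = q ^ Fintype.card n := by
    rw [hLE, Matrix.index_range_mulVec E (hEdet ▸ pow_ne_zero _ hq0), hEdet, Int.natAbs_pow,
      Int.natAbs_natCast]
  have hne : (Finset.univ : Finset (n × Fin (Ω q))).Nonempty := by
    have : Nonempty (Fin (Ω q)) :=
      ⟨⟨0, ArithmeticFunction.cardFactors_pos_iff_one_lt.2 hq1⟩⟩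
    exact Finset.univ_nonempty
  obtain ⟨⟨i, k⟩, -, hik⟩ := exists_eq_top_of_cover hHK hH hp Finset.univ hne
    (fun x hx => by
      classical
      rw [hL] at hx
      push Not at hx
      let z : n → ℤ := fun i => if (m : ℤ) * q ∣ (C *ᵥ x) i then (C *ᵥ x) i / (m * q) else 0
      have hz : ∀ i, (C *ᵥ (x - E *ᵥ z)) i =
          if (m : ℤ) * q ∣ (C *ᵥ x) i then 0 else (C *ᵥ x) i := by
        intro i
        rw [Matrix.mulVec_sub, hCE, Pi.sub_apply, Pi.smul_apply, smul_eq_mul]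
        by_cases hi : (m : ℤ) * q ∣ (C *ᵥ x) i
        · simp only [z, if_pos hi, Int.mul_ediv_cancel' hi, sub_self]
        · simp only [z, if_neg hi, mul_zero, sub_zero]
      obtain ⟨i₀, hi₀⟩ := hx
      obtain ⟨i, hi, hi'⟩ := h (x - E *ᵥ z) (fun h0 => hi₀ (by
        have := hz i₀
        rw [h0, Matrix.mulVec_zero, if_neg hi₀] at this
        rw [← this]
        exact dvd_zero _))
      rw [hz] at hi hi'
      have hmq : ¬ (m : ℤ) * q ∣ (C *ᵥ x) i := fun hd => hi' (if_pos hd)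
      rw [if_neg hmq] at hi
      have hex : ∃ k, ¬ (m : ℤ) * c k ∣ (C *ᵥ x) i := ⟨Ω q, by rwa [hcq]⟩
      obtain ⟨k, hk⟩ : ∃ k, Nat.find hex = k + 1 := by
        refine Nat.exists_eq_succ_of_ne_zero fun h0 => ?_
        have := Nat.find_spec hex
        rw [h0, hc0, Nat.cast_one, mul_one] at this
        exact this hi
      have hklt : k < Ω q := by
        have : Nat.find hex ≤ Ω q := Nat.find_min' hex (by rwa [hcq])
        omega
      refine ⟨(i, ⟨k, hklt⟩), Finset.mem_univ _, (hG _ _ _).2 ?_, fun hmem => ?_⟩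
      · exact not_not.1 (Nat.find_min hex (by omega : k < Nat.find hex))
      · have := Nat.find_spec hex
        rw [hk] at this
        exact this ((hG _ _ _).1 hmem))
    (by
      rw [hindex, ArithmeticFunction.cardFactors_pow, Finset.card_univ, Fintype.card_prod,
        Fintype.card_fin])
  refine ⟨i, fun j => ?_⟩
  have hmem : Pi.single j 1 ∈ G i k := by
    change Pi.single j 1 ∈ K (i, k)
    rw [hik]
    exact AddSubgroup.mem_top _
  rw [hG, Matrix.mulVec_single_one] at hmem
  exact (Dvd.intro _ rfl).trans hmem

end IntegerMatrix

section RealMatrix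

open Matrix MeasureTheory

/-- Minkowski's theorem on linear forms. -/
theorem Matrix.exists_int_mulVec_lt_one {n : Type*} [Fintype n] [DecidableEq n] (B : Matrix n n ℝ)
    (h0 : B.det ≠ 0) (h1 : |B.det| < 1) :
    ∃ x : n → ℤ, x ≠ 0 ∧ ∀ i, |(B *ᵥ fun j => (x j : ℝ)) i| < 1 := by
  let b := Pi.basisFun ℝ n
  let s : Set (n → ℝ) := Set.univ.pi fun _ => Set.Ioo (-1) 1
  have hdet : LinearMap.det B.mulVecLin = B.det := LinearMap.det_toLin' B
  have hs : volume s = 2 ^ Fintype.card n := by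
    rw [volume_pi, Measure.pi_pi, Real.volume_Ioo, Finset.prod_const, Finset.card_univ]
    norm_num
  have hvol : volume (ZSpan.fundamentalDomain b) * 2 ^ Module.finrank ℝ (n → ℝ) <
      volume (B.mulVecLin ⁻¹' s) := by
    rw [Measure.addHaar_preimage_linearMap _ (hdet ▸ h0), hdet, hs,
      ZSpan.fundamentalDomain_pi_basisFun,
      volume_pi, Measure.pi_pi, Real.volume_Ico, sub_zero, ENNReal.ofReal_one,
      Finset.prod_const_one, Module.finrank_fintype_fun_eq_card]
    refine ENNReal.mul_lt_mul_left (by positivity) (by finiteness) ?_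
    rw [ENNReal.one_lt_ofReal, abs_inv]
    exact (one_lt_inv₀ (abs_pos.2 h0)).2 h1
  have : Countable (Submodule.span ℤ (Set.range b)).toAddSubgroup :=
    inferInstanceAs (Countable (Submodule.span ℤ (Set.range b)))
  obtain ⟨⟨x, hx⟩, hx0, hxs⟩ := exists_ne_zero_mem_lattice_of_measure_mul_two_pow_lt_measure
    (ZSpan.isAddFundamentalDomain' b volume)
    (s := B.mulVecLin ⁻¹' s)
    (fun x hx i hi => by
      have := hx i hi
      rw [map_neg, Pi.neg_apply]
      exact ⟨neg_lt_neg this.2, neg_lt.1 this.1⟩)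
    ((convex_pi fun _ _ => convex_Ioo _ _).linear_preimage _) hvol
  have hxz := (b.mem_span_iff_repr_mem ℤ x).1 hx
  choose z hz using hxz
  have hzx : (fun j => (z j : ℝ)) = x := funext fun j => by simpa [b] using hz j
  refine ⟨z, ?_, fun i => ?_⟩
  · rintro rfl
    apply hx0
    ext i
    simp [← hzx]
  · rw [hzx, abs_lt]
    exact hxs i (Set.mem_univ i)

theorem Real.exists_rat_linearMap_ne_intCast {b : ℝ} (hb : ∀ z : ℤ, b ≠ z) :
    ∃ r : ℝ →ₗ[ℚ] ℚ, r 1 = 1 ∧ ∀ z : ℤ, r b ≠ z := by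
  let p : Submodule ℚ ℝ := (Algebra.linearMap ℚ ℝ).range
  let e : ℚ ≃ₗ[ℚ] p :=
    LinearEquiv.ofInjective (Algebra.linearMap ℚ ℝ) (algebraMap ℚ ℝ).injective
  have he : ∀ (g : ℝ →ₗ[ℚ] ℚ), g ∘ₗ p.subtype = e.symm.toLinearMap → ∀ q : ℚ, g q = q := by
    intro g hg q
    have := LinearMap.congr_fun hg (e q)
    rwa [LinearEquiv.coe_coe, e.symm_apply_apply] at this
  by_cases hbp : b ∈ p
  · obtain ⟨q, rfl⟩ := hbp
    obtain ⟨g, hg⟩ := LinearMap.exists_extend e.symm.toLinearMap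
    refine ⟨g, by simpa using he g hg 1, fun z hz => hb z ?_⟩
    have hq : g (Algebra.linearMap ℚ ℝ q) = q := he g hg q
    rw [hq] at hz
    simp [hz]
  · obtain ⟨g, hg, hgb⟩ := LinearMap.exists_extend_of_notMem e.symm.toLinearMap hbp (1 / 2)
    refine ⟨g, by simpa using he g hg 1, fun z hz => ?_⟩
    rw [hgb] at hz
    have : (1 : ℤ) = 2 * z := by
      have : (1 : ℚ) = 2 * z := by linarith
      exact_mod_cast this
    omega

/-- Every nonzero integer vector has an image under `B` with a nonzero integer coordinate. -/
def Matrix.HasIntCoord {n : Type*} [Fintype n] (B : Matrix n n ℝ) : Prop :=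
  ∀ x : n → ℤ, x ≠ 0 → ∃ i, ∃ z : ℤ, z ≠ 0 ∧ (B *ᵥ fun j => (x j : ℝ)) i = z

theorem Matrix.HasIntCoord.one_le_abs_det {n : Type*} [Fintype n] [DecidableEq n]
    {B : Matrix n n ℝ} (hB : B.HasIntCoord) (h0 : B.det ≠ 0) : 1 ≤ |B.det| := by
  by_contra! h1
  obtain ⟨x, hx, hlt⟩ := B.exists_int_mulVec_lt_one h0 h1
  obtain ⟨i, z, hz, hi⟩ := hB x hx
  have := hlt i
  rw [hi] at this
  exact hz (Int.abs_lt_one_iff.1 (by exact_mod_cast this))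

theorem Matrix.HasIntCoord.updateRow_add_smul {n : Type*} [Fintype n] [DecidableEq n]
    {B : Matrix n n ℝ} (hB : B.HasIntCoord) {s : ℝ →ₗ[ℚ] ℝ} (hs : s 1 = 0) (i : n) (t : ℝ) :
    (B.updateRow i (B i + t • fun j => s (B i j))).HasIntCoord := by
  intro x hx
  obtain ⟨k, z, hz, hk⟩ := hB x hx
  refine ⟨k, z, hz, ?_⟩
  rw [← hk]
  by_cases hki : k = i
  · subst hki
    have hsz : s ((B *ᵥ fun j => (x j : ℝ)) k) = ∑ j, s (B k j) * x j := by
      simp only [Matrix.mulVec, dotProduct, map_sum]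
      refine Finset.sum_congr rfl fun j _ => ?_
      rw [mul_comm, ← zsmul_eq_mul, map_zsmul, zsmul_eq_mul, mul_comm]
    have h0 : ∑ j, s (B k j) * x j = 0 := by
      rw [← hsz, hk, ← mul_one (z : ℝ), ← zsmul_eq_mul, map_zsmul, hs, smul_zero]
    simp only [Matrix.mulVec, dotProduct, updateRow_self, Pi.add_apply, Pi.smul_apply, smul_eq_mul,
      add_mul, Finset.sum_add_distrib, mul_assoc, ← Finset.mul_sum, h0, mul_zero, add_zero]
  · simp only [Matrix.mulVec, updateRow_ne hki]

theorem Matrix.HasIntCoord.det_updateRow_eq_zero {n : Type*} [Fintype n] [DecidableEq n]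
    {B : Matrix n n ℝ} (hB : B.HasIntCoord) (hdet : B.det = 1) {s : ℝ →ₗ[ℚ] ℝ} (hs : s 1 = 0)
    (i : n) : (B.updateRow i fun j => s (B i j)).det = 0 := by
  by_contra hc
  set c := (B.updateRow i fun j => s (B i j)).det with hcdef
  have h1 := hB.updateRow_add_smul hs i (-1 / (2 * c))
  have h2 : (B.updateRow i (B i + (-1 / (2 * c)) • fun j => s (B i j))).det = 1 / 2 := by
    rw [det_updateRow_add, det_updateRow_smul, updateRow_eq_self, hdet, ← hcdef]
    field_simp
    norm_num
  have := h1.one_le_abs_det (by rw [h2]; norm_num)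
  rw [h2, abs_of_pos (by norm_num)] at this
  norm_num at this

/-- One row can be made rational without becoming integral. -/
theorem Matrix.HasIntCoord.exists_updateRow_rat {n : Type*} [Fintype n] [DecidableEq n]
    {B : Matrix n n ℝ} (hB : B.HasIntCoord) (hdet : B.det = 1) {i j : n}
    (hij : ∀ z : ℤ, B i j ≠ z) :
    ∃ v : n → ℚ, (∀ z : ℤ, v j ≠ z) ∧ (B.updateRow i fun j => (v j : ℝ)).HasIntCoord ∧
      (B.updateRow i fun j => (v j : ℝ)).det = 1 := by
  obtain ⟨r, hr1, hrb⟩ := Real.exists_rat_linearMap_ne_intCast hij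
  let s : ℝ →ₗ[ℚ] ℝ := Algebra.linearMap ℚ ℝ ∘ₗ r - LinearMap.id
  have hs : s 1 = 0 := by simp [s, hr1]
  have hv : (fun j => (r (B i j) : ℝ)) = B i + (1 : ℝ) • fun j => s (B i j) := by
    ext j
    simp [s]
  refine ⟨fun j => r (B i j), hrb, ?_, ?_⟩
  · rw [hv]
    exact hB.updateRow_add_smul hs i 1
  · rw [hv, det_updateRow_add, det_updateRow_smul, hB.det_updateRow_eq_zero hdet hs,
      updateRow_eq_self, hdet, mul_zero, add_zero]

theorem Matrix.HasIntCoord.exists_rat {n : Type*} [Fintype n] [DecidableEq n]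
    {B : Matrix n n ℝ} (hB : B.HasIntCoord) (hdet : B.det = 1)
    (hrow : ∀ i, ∃ j, ∀ z : ℤ, B i j ≠ z) :
    ∃ A : Matrix n n ℚ, (A.map ((↑) : ℚ → ℝ)).HasIntCoord ∧ (A.map ((↑) : ℚ → ℝ)).det = 1 ∧
      ∀ i, ∃ j, ∀ z : ℤ, A i j ≠ z := by
  have key : ∀ S : Finset n, ∃ B' : Matrix n n ℝ, B'.HasIntCoord ∧ B'.det = 1 ∧
      (∀ i, ∃ j, ∀ z : ℤ, B' i j ≠ z) ∧ ∀ i ∈ S, ∀ j, ∃ q : ℚ, B' i j = q := by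
    intro S
    induction S using Finset.induction with
    | empty => exact ⟨B, hB, hdet, hrow, by simp⟩
    | insert i S hi ih =>
      obtain ⟨B', hB', hdet', hrow', hS⟩ := ih
      obtain ⟨j, hj⟩ := hrow' i
      obtain ⟨v, hv, hB'', hdet''⟩ := hB'.exists_updateRow_rat hdet' hj
      refine ⟨_, hB'', hdet'', fun k => ?_, fun k hk l => ?_⟩
      · by_cases hki : k = i
        · subst hki
          refine ⟨j, fun z hz => hv z ?_⟩
          rw [updateRow_self] at hz
          exact_mod_cast hz
        · rw [updateRow_ne hki]
          exact hrow' k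
      · by_cases hki : k = i
        · subst hki
          exact ⟨v l, by rw [updateRow_self]⟩
        · rw [updateRow_ne hki]
          exact hS k (Finset.mem_of_mem_insert_of_ne hk hki) l
  obtain ⟨B', hB', hdet', hrow', hS⟩ := key Finset.univ
  choose A hA using fun i => hS i (Finset.mem_univ i)
  have hAB : (Matrix.of A).map ((↑) : ℚ → ℝ) = B' := by
    ext i j
    exact (hA i j).symm
  refine ⟨Matrix.of A, hAB ▸ hB', hAB ▸ hdet', fun i => ?_⟩
  obtain ⟨j, hj⟩ := hrow' i
  refine ⟨j, fun z hz => hj z ?_⟩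
  rw [hA, show A i j = z from hz, Rat.cast_intCast]

end RealMatrix

/-- Minkowski's conjecture (Hajós' theorem), second form: if `det B = 1` and for every
nonzero integer vector `x` some coordinate of `Bx` is a nonzero integer, then some row
of `B` is an integer vector. -/
theorem minkowski_hajos_second_form {d : ℕ} (hd : 0 < d)
    (B : Matrix (Fin d) (Fin d) ℝ) (hdet : B.det = 1)
    (h : ∀ x : Fin d → ℤ, x ≠ 0 →
      ∃ i : Fin d, ∃ z : ℤ, z ≠ 0 ∧ B.mulVec (fun j => (x j : ℝ)) i = (z : ℝ)) :
    ∃ i : Fin d, ∀ j : Fin d, ∃ z : ℤ, B i j = (z : ℝ) := by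
  by_contra! hrow
  obtain ⟨A, hA, hdetA, hrowA⟩ := Matrix.HasIntCoord.exists_rat h hdet hrow
  have : Nonempty (Fin d) := ⟨⟨0, hd⟩⟩
  obtain ⟨m, hm, C, hC⟩ : ∃ m : ℕ, 1 < m ∧ ∃ C : Matrix (Fin d) (Fin d) ℤ,
      ∀ i j, (C i j : ℝ) = m * A i j := by
    let N : ℕ := ∏ p : Fin d × Fin d, (A p.1 p.2).den
    have hN : 0 < N := Finset.prod_pos fun p _ => (A p.1 p.2).den_pos
    refine ⟨2 * N, by omega, ?_⟩
    have : ∀ i j, ∃ z : ℤ, (z : ℝ) = (2 * N : ℕ) * A i j := by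
      intro i j
      obtain ⟨k, hk⟩ : (A i j).den ∣ N :=
        Finset.dvd_prod_of_mem (fun p : Fin d × Fin d => (A p.1 p.2).den)
          (Finset.mem_univ (i, j))
      refine ⟨2 * k * (A i j).num, ?_⟩
      have := Rat.den_mul_eq_num (A i j)
      rw [hk]
      have h' : (2 * k * (A i j).num : ℚ) = 2 * ((A i j).den * k) * A i j := by
        rw [← this]; ring
      exact_mod_cast h'
    choose C hC using this
    exact ⟨C, hC⟩
  have hm0 : (m : ℝ) ≠ 0 := by positivity
  have hCm : C.map ((↑) : ℤ → ℝ) = (m : ℝ) • A.map ((↑) : ℚ → ℝ) := by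
    ext i j
    exact hC i j
  have hCx : ∀ (x : Fin d → ℤ) i, ((C.mulVec x i : ℤ) : ℝ) =
      m * (A.map ((↑) : ℚ → ℝ)).mulVec (fun j => (x j : ℝ)) i := by
    intro x i
    simp only [Matrix.mulVec, dotProduct, Int.cast_sum, Int.cast_mul, hC, Finset.mul_sum,
      Matrix.map_apply, mul_assoc]
  obtain ⟨i, hi⟩ := exists_row_dvd C hm
    (by
      have := congrArg Matrix.det hCm
      rw [Matrix.det_smul, hdetA, mul_one] at this
      have h2 : ((C.det : ℤ) : ℝ) = (C.map ((↑) : ℤ → ℝ)).det := Int.cast_det C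
      rw [this] at h2
      exact_mod_cast h2)
    (fun x hx => by
      obtain ⟨i, z, hz, hi⟩ := hA x hx
      have hz' : C.mulVec x i = m * z := by
        have := hCx x i
        rw [hi] at this
        exact_mod_cast this
      refine ⟨i, ⟨z, hz'⟩, ?_⟩
      rw [hz']
      exact mul_ne_zero (by omega) hz)
  obtain ⟨j, hj⟩ := hrowA i
  obtain ⟨z, hz⟩ := hi j
  refine hj z ?_
  have := hC i j
  rw [hz, Int.cast_mul, Int.cast_natCast] at this
  exact_mod_cast (mul_left_cancel₀ hm0 this).symm
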